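/- arXiv:1010.6300 — 2 statements merged into one kernel-verified Lean document; each statement's English description precedes it below -/
import Mathlib

section
/- For every x ∈ (0,1], one has (1/x) − δ_c·[ (1/x + 1)·F(1/2,1/2;1;(1−x)/2)/F(−1/2,3/2;1;(1−x)/2) + (1/x − 1)·(1/3)·F(1/2,1/2;2;(1−x)/2)/F(−1/2,3/2;2;(1−x)/2) ] ≥ 1 − 2δ_c. -/
open Real

/-- The Pochhammer symbol `(a)_k = a(a+1)⋯(a+k−1)`. -/
noncomputable def poch (a : ℝ) (k : ℕ) : ℝ := ∏ i ∈ Finset.range k, (a + i)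

/-- The Gauss hypergeometric series `F(a,b;c;z) = ∑ (a)_k (b)_k / ((c)_k k!) z^k`. -/
noncomputable def Fhyp (a b c z : ℝ) : ℝ :=
  ∑' k : ℕ, poch a k * poch b k / (poch c k * (k.factorial : ℝ)) * z ^ k

/-- The critical coupling `δ_c = (Γ(1/4)⁴/(8π²) + 8π²/Γ(1/4)⁴)⁻¹`. -/
noncomputable def deltaC : ℝ :=
  (Real.Gamma (1/4) ^ 4 / (8 * Real.pi ^ 2) + 8 * Real.pi ^ 2 / Real.Gamma (1/4) ^ 4)⁻¹

/-- The coefficients of the Gauss hypergeometric series. -/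
noncomputable def hypCoeff (a b c : ℝ) (k : ℕ) : ℝ :=
  poch a k * poch b k / (poch c k * (k.factorial : ℝ))

theorem Fhyp_eq_tsum (a b c z : ℝ) : Fhyp a b c z = ∑' k : ℕ, hypCoeff a b c k * z ^ k := rfl

theorem poch_succ (a : ℝ) (k : ℕ) : poch a (k + 1) = poch a k * (a + k) :=
  Finset.prod_range_succ _ _

theorem poch_pos {a : ℝ} (ha : 0 < a) (k : ℕ) : 0 < poch a k :=
  Finset.prod_pos fun i _ => by positivity

theorem hypCoeff_zero (a b c : ℝ) : hypCoeff a b c 0 = 1 := by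
  simp [hypCoeff, poch]

theorem hypCoeff_succ (a b c : ℝ) (k : ℕ) :
    hypCoeff a b c (k + 1) = hypCoeff a b c k * ((a + k) * (b + k) / ((c + k) * (k + 1))) := by
  simp only [hypCoeff, poch_succ, Nat.factorial_succ, Nat.cast_mul, Nat.cast_succ]
  rw [div_mul_div_comm]
  congr 1 <;> ring

theorem abs_hypCoeff_succ_le {a c : ℝ} (ha : |a * (1 - a)| ≤ 3 / 4) (hc : 1 ≤ c) (k : ℕ) :
    |hypCoeff a (1 - a) c (k + 1)| ≤ 3 / 4 / c := by
  have hc0 : 0 < c := by linarith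
  induction k with
  | zero =>
    rw [hypCoeff_succ, hypCoeff_zero]
    simp only [Nat.cast_zero, add_zero, zero_add, mul_one, one_mul]
    rw [abs_div, abs_of_pos hc0]
    gcongr
  | succ k ih =>
    rw [hypCoeff_succ, abs_mul]
    refine (mul_le_of_le_one_right (abs_nonneg _) ?_).trans ih
    have hk : (0 : ℝ) ≤ ((k + 1 : ℕ) : ℝ) := Nat.cast_nonneg _
    generalize ((k + 1 : ℕ) : ℝ) = m at hk
    have hden : 0 < (c + m) * (m + 1) := by positivity
    rw [abs_div, abs_of_pos hden, div_le_one hden, abs_le]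
    obtain ⟨h₁, h₂⟩ := abs_le.1 ha
    constructor <;> nlinarith

theorem abs_hypCoeff_le_one {a c : ℝ} (ha : |a * (1 - a)| ≤ 3 / 4) (hc : 1 ≤ c) (k : ℕ) :
    |hypCoeff a (1 - a) c k| ≤ 1 := by
  cases k with
  | zero => simp [hypCoeff_zero]
  | succ k =>
    refine (abs_hypCoeff_succ_le ha hc k).trans ?_
    rw [div_le_one (by linarith)]
    linarith

theorem summable_hypCoeff {a c z : ℝ} (ha : |a * (1 - a)| ≤ 3 / 4) (hc : 1 ≤ c)
    (hz0 : 0 ≤ z) (hz1 : z < 1) : Summable fun k => hypCoeff a (1 - a) c k * z ^ k := by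
  refine Summable.of_norm_bounded (summable_geometric_of_lt_one hz0 hz1) fun k => ?_
  rw [Real.norm_eq_abs, abs_mul, abs_of_nonneg (pow_nonneg hz0 k)]
  exact mul_le_of_le_one_left (pow_nonneg hz0 k) (abs_hypCoeff_le_one ha hc k)

theorem summable_hypCoeff_succ {a c z : ℝ} (ha : |a * (1 - a)| ≤ 3 / 4) (hc : 1 ≤ c)
    (hz0 : 0 ≤ z) (hz1 : z < 1) : Summable fun k => hypCoeff a (1 - a) c (k + 1) * z ^ k := by
  refine Summable.of_norm_bounded (summable_geometric_of_lt_one hz0 hz1) fun k => ?_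
  rw [Real.norm_eq_abs, abs_mul, abs_of_nonneg (pow_nonneg hz0 k)]
  exact mul_le_of_le_one_left (pow_nonneg hz0 k) (abs_hypCoeff_le_one ha hc (k + 1))

theorem Fhyp_eq_one_add {a c z : ℝ} (ha : |a * (1 - a)| ≤ 3 / 4) (hc : 1 ≤ c)
    (hz0 : 0 ≤ z) (hz1 : z < 1) :
    Fhyp a (1 - a) c z = 1 + z * ∑' k : ℕ, hypCoeff a (1 - a) c (k + 1) * z ^ k := by
  rw [Fhyp_eq_tsum, (summable_hypCoeff ha hc hz0 hz1).tsum_eq_zero_add, hypCoeff_zero,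
    ← tsum_mul_left]
  simp only [pow_zero, mul_one, pow_succ]
  congr 1
  exact tsum_congr fun k => by ring

theorem abs_Fhyp_half_sub_one_le {a c : ℝ} (ha : |a * (1 - a)| ≤ 3 / 4) (hc : 1 ≤ c) :
    |Fhyp a (1 - a) c (1 / 2) - 1| ≤ 3 / 4 / c := by
  have hs := summable_hypCoeff_succ ha hc (z := 1 / 2) (by norm_num) (by norm_num)
  have hg : HasSum (fun k : ℕ => 3 / 4 / c * (1 / 2 : ℝ) ^ k) (3 / 4 / c * 2) :=
    hasSum_geometric_two.mul_left _
  have hb : ‖∑' k : ℕ, hypCoeff a (1 - a) c (k + 1) * (1 / 2) ^ k‖ ≤ 3 / 4 / c * 2 :=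
    tsum_of_norm_bounded hg fun k => by
      rw [Real.norm_eq_abs, abs_mul, abs_of_nonneg (a := (1 / 2 : ℝ) ^ k) (by positivity)]
      exact mul_le_mul_of_nonneg_right (abs_hypCoeff_succ_le ha hc k) (by positivity)
  rw [Fhyp_eq_one_add ha hc (by norm_num) (by norm_num), add_sub_cancel_left, abs_mul,
    abs_of_pos (by norm_num : (0 : ℝ) < 1 / 2)]
  rw [Real.norm_eq_abs] at hb
  linarith

theorem hypCoeff_add_two {a b c : ℝ} (hc : 0 < c) (k : ℕ) :
    hypCoeff a b (c + 2) k = hypCoeff a b c k * (c * (c + 1) / ((c + k) * (c + k + 1))) := by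
  induction k with
  | zero => rw [hypCoeff_zero, hypCoeff_zero]; field_simp; simp
  | succ k ih =>
    rw [hypCoeff_succ, hypCoeff_succ, ih]
    push_cast
    field_simp
    ring

/-- The contiguous relation behind Bailey's summation theorem; the difference of the two series
telescopes. -/
theorem Fhyp_half_contiguous {a c : ℝ} (ha : |a * (1 - a)| ≤ 3 / 4) (hc : 1 ≤ c) :
    c * (c + 1) * Fhyp a (1 - a) c (1 / 2) =
      (c + a) * (c + 1 - a) * Fhyp a (1 - a) (c + 2) (1 / 2) := by
  have hc0 : 0 < c := by linarith
  set t : ℕ → ℝ := fun k => hypCoeff a (1 - a) c k * (1 / 2) ^ k with ht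
  have hs : Summable t := summable_hypCoeff ha hc (by norm_num) (by norm_num)
  have hs' : Summable fun k => hypCoeff a (1 - a) (c + 2) k * (1 / 2 : ℝ) ^ k :=
    summable_hypCoeff ha (by linarith) (by norm_num) (by norm_num)
  set G : ℕ → ℝ := fun k => -2 * c * (c + 1) * (k / (c + k)) * t k with hG
  have hGlim : Filter.Tendsto G Filter.atTop (nhds 0) := by
    refine squeeze_zero_norm (a := fun k => 2 * c * (c + 1) * |t k|) (fun k => ?_) ?_
    · have h1 : (k : ℝ) / (c + k) ≤ 1 := by
        rw [div_le_one (by positivity)]; linarith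
      have h0 : 0 ≤ (k : ℝ) / (c + k) := by positivity
      rw [hG, Real.norm_eq_abs, abs_mul]
      refine mul_le_mul_of_nonneg_right ?_ (abs_nonneg _)
      rw [abs_mul, abs_of_nonneg h0, abs_of_neg (by nlinarith : -2 * c * (c + 1) < 0)]
      have : 0 < c * (c + 1) := by positivity
      nlinarith
    · simpa using (hs.tendsto_atTop_zero.abs).const_mul (2 * c * (c + 1))
  have hdiff : ∀ k, c * (c + 1) * t k -
      (c + a) * (c + 1 - a) * (hypCoeff a (1 - a) (c + 2) k * (1 / 2) ^ k) =
      G (k + 1) - G k := by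
    intro k
    simp only [hG, ht, hypCoeff_add_two hc0, hypCoeff_succ, pow_succ]
    push_cast
    have h1 : c + k ≠ 0 := by positivity
    have h2 : c + k + 1 ≠ 0 := by positivity
    have h3 : c + (k + 1) ≠ 0 := by positivity
    field_simp
    ring
  have hsum : HasSum (fun k => G (k + 1) - G k) (c * (c + 1) * Fhyp a (1 - a) c (1 / 2) -
      (c + a) * (c + 1 - a) * Fhyp a (1 - a) (c + 2) (1 / 2)) := by
    simp only [← hdiff]
    exact (hs.hasSum.mul_left _).sub (hs'.hasSum.mul_left _)
  have hpart := hsum.tendsto_sum_nat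
  simp only [Finset.sum_range_sub] at hpart
  have hG0 : G 0 = 0 := by simp [hG]
  rw [hG0] at hpart
  simp only [sub_zero] at hpart
  exact sub_eq_zero.1 (tendsto_nhds_unique hpart hGlim)

theorem Fhyp_half_contiguous_iterate {a c : ℝ} (ha : |a * (1 - a)| ≤ 3 / 4) (hc : 1 ≤ c) (n : ℕ) :
    (∏ j ∈ Finset.range n, (c / 2 + j)) * (∏ j ∈ Finset.range n, ((c + 1) / 2 + j)) *
        Fhyp a (1 - a) c (1 / 2) =
      (∏ j ∈ Finset.range n, ((c + a) / 2 + j)) * (∏ j ∈ Finset.range n, ((c + 1 - a) / 2 + j)) *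
        Fhyp a (1 - a) (c + 2 * n) (1 / 2) := by
  induction n with
  | zero => simp
  | succ n ih =>
    have hn : (0 : ℝ) ≤ n := Nat.cast_nonneg n
    have h := Fhyp_half_contiguous ha (c := c + 2 * n) (by linarith)
    have hcast : c + 2 * ((n + 1 : ℕ) : ℝ) = c + 2 * n + 2 := by push_cast; ring
    rw [hcast]
    simp only [Finset.prod_range_succ]
    linear_combination (c / 2 + n) * ((c + 1) / 2 + n) * ih +
      (∏ j ∈ Finset.range n, ((c + a) / 2 + (j : ℝ))) *
        (∏ j ∈ Finset.range n, ((c + 1 - a) / 2 + (j : ℝ))) / 4 * h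

theorem tendsto_Fhyp_half {a c : ℝ} (ha : |a * (1 - a)| ≤ 3 / 4) (hc : 1 ≤ c) :
    Filter.Tendsto (fun n : ℕ => Fhyp a (1 - a) (c + 2 * ((n + 1 : ℕ) : ℝ)) (1 / 2))
      Filter.atTop (nhds 1) := by
  rw [tendsto_iff_norm_sub_tendsto_zero]
  refine squeeze_zero (fun _ => norm_nonneg _) (g := fun n : ℕ => 1 / ((n : ℝ) + 1))
    (fun n => ?_) tendsto_one_div_add_atTop_nhds_zero_nat
  have hn : (0 : ℝ) ≤ n := Nat.cast_nonneg n
  push_cast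
  refine (abs_Fhyp_half_sub_one_le ha (by linarith)).trans ?_
  rw [div_le_div_iff₀ (by linarith) (by linarith)]
  linarith

/-- **Bailey's summation theorem** at `z = 1/2`. -/
theorem Fhyp_half_mul_Gamma {a c : ℝ} (ha : |a * (1 - a)| ≤ 3 / 4) (hc : 1 ≤ c)
    (h₁ : 0 < c + a) (h₂ : 0 < c + 1 - a) :
    Fhyp a (1 - a) c (1 / 2) * (Gamma ((c + a) / 2) * Gamma ((c + 1 - a) / 2)) =
      Gamma (c / 2) * Gamma ((c + 1) / 2) := by
  have hL := ((GammaSeq_tendsto_Gamma ((c + a) / 2)).mul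
    (GammaSeq_tendsto_Gamma ((c + 1 - a) / 2))).const_mul (Fhyp a (1 - a) c (1 / 2))
  have hR := (tendsto_Fhyp_half ha hc).mul ((GammaSeq_tendsto_Gamma (c / 2)).mul
    (GammaSeq_tendsto_Gamma ((c + 1) / 2)))
  rw [one_mul] at hR
  refine tendsto_nhds_unique (hL.congr' ?_) hR
  filter_upwards [Filter.eventually_gt_atTop 0] with n hn
  have hn' : (0 : ℝ) < n := Nat.cast_pos.2 hn
  have hprod : ∀ s : ℝ, 0 < s → (∏ j ∈ Finset.range (n + 1), (s + (j : ℝ))) ≠ 0 := fun s hs =>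
    (Finset.prod_pos fun j _ => by positivity).ne'
  have e₁ := hprod (c / 2) (by linarith)
  have e₂ := hprod ((c + 1) / 2) (by linarith)
  have e₃ := hprod ((c + a) / 2) (by linarith)
  have e₄ := hprod ((c + 1 - a) / 2) (by linarith)
  have hpow : (n : ℝ) ^ ((c + a) / 2) * (n : ℝ) ^ ((c + 1 - a) / 2) =
      (n : ℝ) ^ (c / 2) * (n : ℝ) ^ ((c + 1) / 2) := by
    rw [← rpow_add hn', ← rpow_add hn']
    ring_nf
  have hit := Fhyp_half_contiguous_iterate ha hc (n + 1)
  simp only [GammaSeq]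
  rw [div_mul_div_comm, div_mul_div_comm, mul_div_assoc', mul_div_assoc',
    div_eq_div_iff (mul_ne_zero e₃ e₄) (mul_ne_zero e₁ e₂)]
  linear_combination (n : ℝ) ^ ((c + a) / 2) * (n : ℝ) ^ ((c + 1 - a) / 2) *
      (n.factorial : ℝ) ^ 2 * hit +
    (n.factorial : ℝ) ^ 2 * Fhyp a (1 - a) (c + 2 * ((n + 1 : ℕ) : ℝ)) (1 / 2) *
      ((∏ j ∈ Finset.range (n + 1), ((c + a) / 2 + (j : ℝ))) *
        (∏ j ∈ Finset.range (n + 1), ((c + 1 - a) / 2 + (j : ℝ)))) * hpow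

theorem hypCoeff_half_nonneg {c : ℝ} (hc : 0 < c) (k : ℕ) :
    0 ≤ hypCoeff (1 / 2) (1 / 2) c k := by
  have := poch_pos (by norm_num : (0 : ℝ) < 1 / 2) k
  have := poch_pos hc k
  unfold hypCoeff
  positivity

theorem hypCoeff_neg_half_succ_nonpos {c : ℝ} (hc : 0 < c) (k : ℕ) :
    hypCoeff (-(1 / 2)) (3 / 2) c (k + 1) ≤ 0 := by
  induction k with
  | zero =>
    rw [hypCoeff_succ, hypCoeff_zero, one_mul]
    exact div_nonpos_of_nonpos_of_nonneg (by norm_num) (by positivity)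
  | succ k ih =>
    rw [hypCoeff_succ]
    refine mul_nonpos_of_nonpos_of_nonneg ih ?_
    push_cast
    have hk : (0 : ℝ) ≤ k := Nat.cast_nonneg k
    have : (0 : ℝ) ≤ -(1 / 2) + (k + 1) := by linarith
    positivity

theorem hypCoeff_neg_half_succ (k : ℕ) :
    hypCoeff (-(1 / 2)) (3 / 2) 1 (k + 1) =
      -(hypCoeff (1 / 2) (1 / 2) 1 k * (((k : ℝ) + 1) ^ 2 - 1 / 4) / ((k : ℝ) + 1) ^ 2) := by
  induction k with
  | zero => rw [hypCoeff_succ, hypCoeff_zero, hypCoeff_zero]; norm_num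
  | succ k ih =>
    rw [hypCoeff_succ, ih, hypCoeff_succ (1 / 2)]
    push_cast
    field_simp
    ring

theorem tsum_mul_pow_mono {u : ℕ → ℝ} (hu : ∀ k, 0 ≤ u k) {z w : ℝ} (hz : 0 ≤ z) (hzw : z ≤ w)
    (hsz : Summable fun k => u k * z ^ k) (hsw : Summable fun k => u k * w ^ k) :
    ∑' k, u k * z ^ k ≤ ∑' k, u k * w ^ k :=
  hsz.tsum_le_tsum (fun k => mul_le_mul_of_nonneg_left (pow_le_pow_left₀ hz hzw k) (hu k)) hsw

theorem abs_half_mul : |(1 / 2 : ℝ) * (1 - 1 / 2)| ≤ 3 / 4 := by norm_num [abs_le]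

theorem abs_neg_half_mul : |(-(1 / 2) : ℝ) * (1 - -(1 / 2))| ≤ 3 / 4 := by norm_num [abs_le]

theorem one_sub_half : (1 : ℝ) - 1 / 2 = 1 / 2 := by norm_num

theorem one_sub_neg_half : (1 : ℝ) - -(1 / 2) = 3 / 2 := by norm_num

theorem Fhyp_half_mono {c z w : ℝ} (hc : 1 ≤ c) (hz : 0 ≤ z) (hzw : z ≤ w) (hw : w < 1) :
    Fhyp (1 / 2) (1 / 2) c z ≤ Fhyp (1 / 2) (1 / 2) c w := by
  have hs := fun {y : ℝ} => summable_hypCoeff abs_half_mul hc (z := y)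
  rw [one_sub_half] at hs
  exact tsum_mul_pow_mono (hypCoeff_half_nonneg (by linarith)) hz hzw
    (hs hz (hzw.trans_lt hw)) (hs (hz.trans hzw) hw)

theorem Fhyp_half_nonneg {c z : ℝ} (hc : 0 < c) (hz : 0 ≤ z) : 0 ≤ Fhyp (1 / 2) (1 / 2) c z :=
  tsum_nonneg fun k => mul_nonneg (hypCoeff_half_nonneg hc k) (pow_nonneg hz k)

theorem Fhyp_neg_half_anti {c z w : ℝ} (hc : 1 ≤ c) (hz : 0 ≤ z) (hzw : z ≤ w) (hw : w < 1) :
    Fhyp (-(1 / 2)) (3 / 2) c w ≤ Fhyp (-(1 / 2)) (3 / 2) c z := by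
  have hs := fun {y : ℝ} => summable_hypCoeff_succ abs_neg_half_mul hc (z := y)
  have he := fun {y : ℝ} => Fhyp_eq_one_add abs_neg_half_mul hc (z := y)
  rw [one_sub_neg_half] at hs he
  have hsz := (hs hz (hzw.trans_lt hw)).neg
  have hsw := (hs (hz.trans hzw) hw).neg
  have hnonneg : ∀ k, 0 ≤ -hypCoeff (-(1 / 2)) (3 / 2) c (k + 1) := fun k =>
    neg_nonneg.2 (hypCoeff_neg_half_succ_nonpos (by linarith) k)
  simp only [← neg_mul] at hsz hsw
  have hle := tsum_mul_pow_mono hnonneg hz hzw hsz hsw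
  have h0 : 0 ≤ ∑' k, -hypCoeff (-(1 / 2)) (3 / 2) c (k + 1) * z ^ k :=
    tsum_nonneg fun k => mul_nonneg (hnonneg k) (pow_nonneg hz k)
  rw [he hz (hzw.trans_lt hw), he (hz.trans hzw) hw]
  simp only [neg_mul, tsum_neg] at hle h0
  nlinarith

theorem Fhyp_neg_half_pos {c z : ℝ} (hc : 1 ≤ c) (hz : 0 ≤ z) (hz' : z ≤ 1 / 2) :
    0 < Fhyp (-(1 / 2)) (3 / 2) c z := by
  refine lt_of_lt_of_le ?_ (Fhyp_neg_half_anti hc hz hz' (by norm_num))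
  have h := abs_Fhyp_half_sub_one_le abs_neg_half_mul hc
  rw [one_sub_neg_half, abs_le] at h
  have : 3 / 4 / c ≤ 3 / 4 := div_le_self (by norm_num) hc
  linarith [h.1]

theorem summable_hypCoeff_half_div {z : ℝ} (hz : 0 ≤ z) (hz' : z < 1) :
    Summable fun k : ℕ => hypCoeff (1 / 2) (1 / 2) 1 k * (k / (k + 1)) * z ^ k := by
  have hs := summable_hypCoeff abs_half_mul le_rfl hz hz'
  rw [one_sub_half] at hs
  refine Summable.of_nonneg_of_le (fun k => ?_) (fun k => ?_) hs
  · have := hypCoeff_half_nonneg one_pos k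
    positivity
  · refine mul_le_mul_of_nonneg_right ?_ (pow_nonneg hz k)
    refine mul_le_of_le_one_right (hypCoeff_half_nonneg one_pos k) ?_
    rw [div_le_one (by positivity)]
    linarith

theorem one_sub_mul_Fhyp_half {z : ℝ} (hz : 0 ≤ z) (hz' : z < 1) :
    (1 - z) * Fhyp (1 / 2) (1 / 2) 1 z = Fhyp (-(1 / 2)) (3 / 2) 1 z +
      z * ∑' k : ℕ, hypCoeff (1 / 2) (1 / 2) 1 k * (k / (k + 1)) * z ^ k := by
  have hs := summable_hypCoeff abs_half_mul le_rfl hz hz'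
  have hs1 := summable_hypCoeff_succ abs_half_mul le_rfl hz hz'
  have hd1 := summable_hypCoeff_succ abs_neg_half_mul le_rfl hz hz'
  have hN := Fhyp_eq_one_add abs_half_mul le_rfl hz hz'
  have hD := Fhyp_eq_one_add abs_neg_half_mul le_rfl hz hz'
  rw [one_sub_half] at hs hs1 hN
  rw [one_sub_neg_half] at hd1 hD
  have key : ∑' k : ℕ, hypCoeff (1 / 2) (1 / 2) 1 k * (k / (k + 1)) * z ^ k =
      ∑' k : ℕ, hypCoeff (1 / 2) (1 / 2) 1 (k + 1) * z ^ k -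
        ∑' k : ℕ, hypCoeff (1 / 2) (1 / 2) 1 k * z ^ k -
        ∑' k : ℕ, hypCoeff (-(1 / 2)) (3 / 2) 1 (k + 1) * z ^ k := by
    rw [← hs1.tsum_sub hs, ← (hs1.sub hs).tsum_sub hd1]
    refine tsum_congr fun k => ?_
    rw [hypCoeff_neg_half_succ, hypCoeff_succ]
    field_simp
    ring
  rw [← Fhyp_eq_tsum] at key
  linear_combination hN - hD - z * key

/-- On `[0, 1/2]` the function `(1 - z) A(z)` lies below its chord, where `A` is the quotient of
the two series with `c = 1`. -/
theorem one_sub_mul_Fhyp_div_le {z : ℝ} (hz : 0 ≤ z) (hz' : z ≤ 1 / 2) :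
    (1 - z) * (Fhyp (1 / 2) (1 / 2) 1 z / Fhyp (-(1 / 2)) (3 / 2) 1 z) ≤
      1 - 2 * z +
        z * (Fhyp (1 / 2) (1 / 2) 1 (1 / 2) / Fhyp (-(1 / 2)) (3 / 2) 1 (1 / 2)) := by
  have hDz := Fhyp_neg_half_pos le_rfl hz hz'
  have hDh := Fhyp_neg_half_pos le_rfl (by norm_num : (0 : ℝ) ≤ 1 / 2) le_rfl
  have hanti := Fhyp_neg_half_anti le_rfl hz hz' (by norm_num)
  have ez := one_sub_mul_Fhyp_half hz (by linarith)
  have eh := one_sub_mul_Fhyp_half (by norm_num : (0 : ℝ) ≤ 1 / 2) (by norm_num)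
  have hnonneg : ∀ k : ℕ, 0 ≤ hypCoeff (1 / 2) (1 / 2) 1 k * (k / (k + 1) : ℝ) := fun k =>
    mul_nonneg (hypCoeff_half_nonneg one_pos k) (by positivity)
  have hE := tsum_mul_pow_mono hnonneg hz hz' (summable_hypCoeff_half_div hz (by linarith))
    (summable_hypCoeff_half_div (by norm_num) (by norm_num))
  have hE0 : 0 ≤ ∑' k : ℕ, hypCoeff (1 / 2) (1 / 2) 1 k * (k / (k + 1)) * (1 / 2 : ℝ) ^ k :=
    tsum_nonneg fun k => mul_nonneg (hnonneg k) (by positivity)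
  have hq := div_le_div₀ hE0 hE hDh hanti
  have eA : (1 - z) * (Fhyp (1 / 2) (1 / 2) 1 z / Fhyp (-(1 / 2)) (3 / 2) 1 z) = 1 + z *
      ((∑' k : ℕ, hypCoeff (1 / 2) (1 / 2) 1 k * (k / (k + 1)) * z ^ k) /
        Fhyp (-(1 / 2)) (3 / 2) 1 z) := by
    rw [← mul_div_assoc, ez]
    field_simp
  have eB : Fhyp (1 / 2) (1 / 2) 1 (1 / 2) / Fhyp (-(1 / 2)) (3 / 2) 1 (1 / 2) = 2 +
      (∑' k : ℕ, hypCoeff (1 / 2) (1 / 2) 1 k * (k / (k + 1)) * (1 / 2 : ℝ) ^ k) /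
        Fhyp (-(1 / 2)) (3 / 2) 1 (1 / 2) := by
    rw [div_eq_iff hDh.ne', add_mul, div_mul_cancel₀ _ hDh.ne']
    linear_combination 2 * eh
  rw [eA, eB]
  nlinarith

theorem Fhyp_div_le {z : ℝ} (hz : 0 ≤ z) (hz' : z ≤ 1 / 2) :
    Fhyp (1 / 2) (1 / 2) 2 z / Fhyp (-(1 / 2)) (3 / 2) 2 z ≤
      Fhyp (1 / 2) (1 / 2) 2 (1 / 2) / Fhyp (-(1 / 2)) (3 / 2) 2 (1 / 2) :=
  div_le_div₀ (Fhyp_half_nonneg two_pos (by norm_num))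
    (Fhyp_half_mono one_le_two hz hz' (by norm_num))
    (Fhyp_neg_half_pos one_le_two (by norm_num) le_rfl)
    (Fhyp_neg_half_anti one_le_two hz hz' (by norm_num))

theorem Gamma_quarter_mul : Gamma (1 / 4) ^ 2 * Gamma (3 / 4) ^ 2 = 2 * π ^ 2 := by
  have h := Real.Gamma_mul_Gamma_one_sub (1 / 4)
  rw [show (1 : ℝ) - 1 / 4 = 3 / 4 by norm_num, show π * (1 / 4) = π / 4 by ring,
    sin_pi_div_four] at h
  have h2 : √2 ^ 2 = (2 : ℝ) := sq_sqrt (by norm_num)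
  rw [← mul_pow, h, div_pow, div_pow, h2]
  ring

theorem Fhyp_half_one_div :
    Fhyp (1 / 2) (1 / 2) 1 (1 / 2) / Fhyp (-(1 / 2)) (3 / 2) 1 (1 / 2) =
      Gamma (1 / 4) ^ 4 / (8 * π ^ 2) := by
  have hN := Fhyp_half_mul_Gamma abs_half_mul le_rfl (by norm_num) (by norm_num)
  have hD := Fhyp_half_mul_Gamma abs_neg_half_mul le_rfl (by norm_num) (by norm_num)
  have hG : Gamma (5 / 4) = 1 / 4 * Gamma (1 / 4) := by
    rw [← Gamma_add_one (by norm_num)]; norm_num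
  norm_num at hN hD
  rw [hG] at hD
  have hD0 := Fhyp_neg_half_pos le_rfl (by norm_num : (0 : ℝ) ≤ 1 / 2) le_rfl
  have hq := Gamma_quarter_mul
  rw [div_eq_div_iff hD0.ne' (by positivity)]
  linear_combination 4 * Gamma (1 / 4) ^ 2 * (hN - hD) -
    4 * Fhyp (1 / 2) (1 / 2) 1 (1 / 2) * hq

theorem Fhyp_half_two_div :
    Fhyp (1 / 2) (1 / 2) 2 (1 / 2) / Fhyp (-(1 / 2)) (3 / 2) 2 (1 / 2) =
      3 * (8 * π ^ 2 / Gamma (1 / 4) ^ 4) := by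
  have hN := Fhyp_half_mul_Gamma abs_half_mul one_le_two (by norm_num) (by norm_num)
  have hD := Fhyp_half_mul_Gamma abs_neg_half_mul one_le_two (by norm_num) (by norm_num)
  have hG : Gamma (5 / 4) = 1 / 4 * Gamma (1 / 4) := by
    rw [← Gamma_add_one (by norm_num)]; norm_num
  have hG' : Gamma (7 / 4) = 3 / 4 * Gamma (3 / 4) := by
    rw [← Gamma_add_one (by norm_num)]; norm_num
  norm_num at hN hD
  rw [hG] at hN
  rw [hG'] at hD
  have hD0 := Fhyp_neg_half_pos one_le_two (by norm_num : (0 : ℝ) ≤ 1 / 2) le_rfl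
  have hq := Gamma_quarter_mul
  have hg : 0 < Gamma (1 / 4) := Gamma_pos_of_pos (by norm_num)
  rw [mul_div_assoc', div_eq_div_iff hD0.ne' (by positivity)]
  linear_combination 16 * Gamma (1 / 4) ^ 2 * (hN - hD) +
    12 * Fhyp (-(1 / 2)) (3 / 2) 2 (1 / 2) * hq

theorem f_ge_one_sub_two_deltaC (x : ℝ) (hx0 : 0 < x) (hx1 : x ≤ 1) :
    1 / x - deltaC *
        ((1 / x + 1) * Fhyp (1/2) (1/2) 1 ((1 - x) / 2) / Fhyp (-(1/2)) (3/2) 1 ((1 - x) / 2) +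
          (1 / x - 1) * (1/3) *
            Fhyp (1/2) (1/2) 2 ((1 - x) / 2) / Fhyp (-(1/2)) (3/2) 2 ((1 - x) / 2)) ≥
      1 - 2 * deltaC := by
  have hz : 0 ≤ (1 - x) / 2 := by linarith
  have hz' : (1 - x) / 2 ≤ 1 / 2 := by linarith
  have hA := one_sub_mul_Fhyp_div_le hz hz'
  have hB := Fhyp_div_le hz hz'
  have hδ : 0 < deltaC := by
    have : 0 < Gamma (1 / 4) := Gamma_pos_of_pos (by norm_num)
    unfold deltaC
    positivity
  have hδinv : deltaC * (Gamma (1 / 4) ^ 4 / (8 * π ^ 2) + 8 * π ^ 2 / Gamma (1 / 4) ^ 4) = 1 :=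
    inv_mul_cancel₀ (inv_pos.1 hδ).ne'
  rw [Fhyp_half_one_div] at hA
  rw [Fhyp_half_two_div] at hB
  rw [mul_div_assoc, mul_div_assoc]
  set A := Fhyp (1 / 2) (1 / 2) 1 ((1 - x) / 2) / Fhyp (-(1 / 2)) (3 / 2) 1 ((1 - x) / 2)
  set B := Fhyp (1 / 2) (1 / 2) 2 ((1 - x) / 2) / Fhyp (-(1 / 2)) (3 / 2) 2 ((1 - x) / 2)
  set P := Gamma (1 / 4) ^ 4 / (8 * π ^ 2)
  set Q := 8 * π ^ 2 / Gamma (1 / 4) ^ 4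
  have hsum : (1 + x) * A + (1 - x) * (1 / 3) * B ≤ 2 * x + (1 - x) * (P + Q) := by
    nlinarith
  have hmul : x * (1 - 2 * deltaC) ≤ 1 - deltaC * ((1 + x) * A + (1 - x) * (1 / 3) * B) := by
    nlinarith [mul_le_mul_of_nonneg_left hsum hδ.le]
  rw [ge_iff_le, ← mul_le_mul_iff_right₀ hx0]
  refine hmul.trans_eq ?_
  field_simp
end

section
/- For every x with 0 ≤ x ≤ 0.4, one has ∑_{k=0}^∞ [ Γ(−1/4 + k)²/(Γ(1/2 + k)·k!)·x^{2k} − Γ(1/4 + k)²/(Γ(3/2 + k)·k!)·x^{2k+1} ] ≤ 32π^{3/2}/Γ(1/4)² − (2Γ(1/4)²/√π)·x + (4π^{3/2}/Γ(1/4)²)·x². -/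
open Real

lemma Gamma_add_half_sq_le {s : ℝ} (hs : 0 < s) :
    Gamma (s + 1 / 2) ^ 2 ≤ s * Gamma s ^ 2 := by
  have h := Real.Gamma_mul_add_mul_le_rpow_Gamma_mul_rpow_Gamma hs
    (show 0 < s + 1 by linarith) (a := 1 / 2) (b := 1 / 2) (by norm_num) (by norm_num)
    (by norm_num)
  have h0 := Gamma_pos_of_pos hs
  rw [show 1 / 2 * s + 1 / 2 * (s + 1) = s + 1 / 2 by ring, Gamma_add_one hs.ne',
    ← sqrt_eq_rpow, ← sqrt_eq_rpow, ← sqrt_mul h0.le] at h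
  have h1 : 0 ≤ Gamma s * (s * Gamma s) := by positivity
  calc Gamma (s + 1 / 2) ^ 2 ≤ √(Gamma s * (s * Gamma s)) ^ 2 :=
        pow_le_pow_left₀ (Gamma_pos_of_pos (by linarith)).le h 2
    _ = s * Gamma s ^ 2 := by rw [sq_sqrt h1]; ring

lemma Gamma_one_fourth_mul_Gamma_three_fourths :
    Gamma (1 / 4) * Gamma (3 / 4) = √2 * π := by
  have h := Real.Gamma_mul_Gamma_add_half (1 / 4)
  rw [show (1 / 4 + 1 / 2 : ℝ) = 3 / 4 by norm_num, show (2 * (1 / 4) : ℝ) = 1 / 2 by norm_num,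
    show (1 - 1 / 2 : ℝ) = 1 / 2 by norm_num, Gamma_one_half_eq, ← sqrt_eq_rpow] at h
  rw [h, mul_right_comm, mul_self_sqrt pi_pos.le, mul_comm]

lemma Gamma_three_fourths_sq :
    Gamma (3 / 4) ^ 2 = 2 * π ^ 2 / Gamma (1 / 4) ^ 2 := by
  have h0 : Gamma (1 / 4) ≠ 0 := (Gamma_pos_of_pos (by norm_num)).ne'
  rw [eq_div_iff (pow_ne_zero 2 h0), ← mul_pow, mul_comm,
    Gamma_one_fourth_mul_Gamma_three_fourths, mul_pow, sq_sqrt (by norm_num)]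

lemma Gamma_three_halves : Gamma (3 / 2) = √π / 2 := by
  rw [show (3 / 2 : ℝ) = 1 / 2 + 1 by norm_num, Gamma_add_one (by norm_num), Gamma_one_half_eq]
  ring

lemma pi_rpow_three_halves : π ^ ((3 : ℝ) / 2) = π * √π := by
  rw [show (3 / 2 : ℝ) = 1 + 1 / 2 by norm_num, rpow_add pi_pos, rpow_one, sqrt_eq_rpow]

/-- The coefficient of `x ^ (2 * k)`. -/
noncomputable def evenCoeff (k : ℕ) : ℝ :=
  Gamma (-(1/4) + k) ^ 2 / (Gamma (1/2 + k) * (k.factorial : ℝ))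

/-- The coefficient of `-x ^ (2 * k + 1)`. -/
noncomputable def oddCoeff (k : ℕ) : ℝ :=
  Gamma (1/4 + k) ^ 2 / (Gamma (3/2 + k) * (k.factorial : ℝ))

lemma evenCoeff_nonneg (k : ℕ) : 0 ≤ evenCoeff k := by
  have : 0 < Gamma (1/2 + k) := Gamma_pos_of_pos (by positivity)
  unfold evenCoeff
  positivity

lemma oddCoeff_nonneg (k : ℕ) : 0 ≤ oddCoeff k := by
  have : 0 < Gamma (3/2 + k) := Gamma_pos_of_pos (by positivity)
  unfold oddCoeff
  positivity

lemma evenCoeff_succ_le (k : ℕ) : evenCoeff (k + 1) ≤ oddCoeff k := by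
  have h3 : 0 < Gamma (3/2 + k) := Gamma_pos_of_pos (by positivity)
  have h := Gamma_add_half_sq_le (s := 1 / 4 + k) (by positivity)
  have hk : (0 : ℝ) < k.factorial := by positivity
  have hk0 : (0 : ℝ) ≤ k := by positivity
  unfold evenCoeff oddCoeff
  rw [show (-(1/4) + (k + 1 : ℕ) : ℝ) = 1 / 4 + k + 1 / 2 by push_cast; ring,
    show (1/2 + (k + 1 : ℕ) : ℝ) = 3 / 2 + k by push_cast; ring, Nat.factorial_succ,
    div_le_div_iff₀ (by positivity) (by positivity)]
  push_cast
  calc Gamma (1 / 4 + k + 1 / 2) ^ 2 * (Gamma (3 / 2 + k) * k.factorial)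
      ≤ ((k + 1) * Gamma (1 / 4 + k) ^ 2) * (Gamma (3 / 2 + k) * k.factorial) := by
        gcongr
        exact h.trans (mul_le_mul_of_nonneg_right (by linarith) (sq_nonneg _))
    _ = _ := by ring

lemma antitone_oddCoeff : Antitone oddCoeff := by
  refine antitone_nat_of_succ_le fun k => ?_
  have h3 : 0 < Gamma (3/2 + k) := Gamma_pos_of_pos (by positivity)
  have hk : (0 : ℝ) < k.factorial := by positivity
  have hk0 : (0 : ℝ) ≤ k := by positivity
  unfold oddCoeff
  rw [show (1/4 + (k + 1 : ℕ) : ℝ) = 1 / 4 + k + 1 by push_cast; ring,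
    show (3/2 + (k + 1 : ℕ) : ℝ) = 3 / 2 + k + 1 by push_cast; ring, Nat.factorial_succ,
    Gamma_add_one (by positivity), Gamma_add_one (by positivity),
    div_le_div_iff₀ (by positivity) (by positivity)]
  push_cast
  calc ((1 / 4 + k) * Gamma (1 / 4 + k)) ^ 2 * (Gamma (3 / 2 + k) * k.factorial)
      = (1 / 4 + k : ℝ) ^ 2 * (Gamma (1 / 4 + k) ^ 2 * (Gamma (3 / 2 + k) * k.factorial)) := by
        ring
    _ ≤ ((3 / 2 + k) * (k + 1)) *
          (Gamma (1 / 4 + k) ^ 2 * (Gamma (3 / 2 + k) * k.factorial)) := by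
        gcongr
        nlinarith
    _ = _ := by ring

lemma evenCoeff_zero : evenCoeff 0 = 32 * π ^ ((3 : ℝ) / 2) / Gamma (1 / 4) ^ 2 := by
  have h := Gamma_add_one (s := -(1 / 4)) (by norm_num)
  rw [show (-(1 / 4) + 1 : ℝ) = 3 / 4 by norm_num] at h
  have h4 : Gamma (-(1 / 4)) ^ 2 = 16 * Gamma (3 / 4) ^ 2 := by rw [h]; ring
  have h0 : Gamma (1 / 4) ≠ 0 := (Gamma_pos_of_pos (by norm_num)).ne'
  have hp : √π ≠ 0 := (sqrt_pos.2 pi_pos).ne'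
  simp only [evenCoeff, Nat.cast_zero, add_zero, Nat.factorial_zero, Nat.cast_one, mul_one]
  rw [h4, Gamma_three_fourths_sq, Gamma_one_half_eq, pi_rpow_three_halves]
  field_simp
  rw [sq_sqrt pi_pos.le]
  ring

lemma evenCoeff_one : evenCoeff 1 = 4 * π ^ ((3 : ℝ) / 2) / Gamma (1 / 4) ^ 2 := by
  have h0 : Gamma (1 / 4) ≠ 0 := (Gamma_pos_of_pos (by norm_num)).ne'
  have hp : √π ≠ 0 := (sqrt_pos.2 pi_pos).ne'
  simp only [evenCoeff, Nat.cast_one, Nat.factorial_one, mul_one]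
  rw [show (-(1 / 4) + 1 : ℝ) = 3 / 4 by norm_num, show (1 / 2 + 1 : ℝ) = 3 / 2 by norm_num,
    Gamma_three_fourths_sq, Gamma_three_halves, pi_rpow_three_halves]
  field_simp
  rw [sq_sqrt pi_pos.le]
  ring

lemma oddCoeff_zero : oddCoeff 0 = 2 * Gamma (1 / 4) ^ 2 / √π := by
  simp only [oddCoeff, Nat.cast_zero, add_zero, Nat.factorial_zero, Nat.cast_one, mul_one]
  rw [Gamma_three_halves]
  field_simp

lemma summable_oddCoeff_mul_pow {x : ℝ} (hx0 : 0 ≤ x) (hx1 : x < 1) :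
    Summable fun k => oddCoeff k * x ^ (2 * k + 1) := by
  have hgeo := (summable_geometric_of_lt_one (sq_nonneg x) (by nlinarith)).mul_left
    (oddCoeff 0 * x)
  refine hgeo.of_nonneg_of_le (fun k => mul_nonneg (oddCoeff_nonneg k) (by positivity))
    fun k => ?_
  calc oddCoeff k * x ^ (2 * k + 1) ≤ oddCoeff 0 * x ^ (2 * k + 1) := by
        gcongr
        exact antitone_oddCoeff k.zero_le
    _ = oddCoeff 0 * x * (x ^ 2) ^ k := by ring

lemma evenCoeff_succ_mul_pow_le {x : ℝ} (hx0 : 0 ≤ x) (hx1 : x ≤ 1) (k : ℕ) :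
    evenCoeff (k + 1) * x ^ (2 * (k + 1)) ≤ oddCoeff k * x ^ (2 * k + 1) :=
  mul_le_mul (evenCoeff_succ_le k) (pow_le_pow_of_le_one hx0 hx1 (by lia)) (by positivity)
    (oddCoeff_nonneg k)

lemma summable_evenCoeff_mul_pow {x : ℝ} (hx0 : 0 ≤ x) (hx1 : x < 1) :
    Summable fun k => evenCoeff k * x ^ (2 * k) :=
  (summable_nat_add_iff 1).1 <| (summable_oddCoeff_mul_pow hx0 hx1).of_nonneg_of_le
    (fun k => mul_nonneg (evenCoeff_nonneg _) (by positivity))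
    (evenCoeff_succ_mul_pow_le hx0 hx1.le)

theorem P_neg_half_order_neg_one_upper_bound (x : ℝ) (hx0 : 0 ≤ x) (hx : x ≤ 0.4) :
    (∑' k : ℕ,
        (Real.Gamma (-(1/4) + k) ^ 2 / (Real.Gamma (1/2 + k) * (k.factorial : ℝ)) *
            x ^ (2 * k) -
          Real.Gamma (1/4 + k) ^ 2 / (Real.Gamma (3/2 + k) * (k.factorial : ℝ)) *
            x ^ (2 * k + 1))) ≤
      32 * Real.pi ^ ((3:ℝ)/2) / Real.Gamma (1/4) ^ 2 -
        2 * Real.Gamma (1/4) ^ 2 / Real.sqrt Real.pi * x +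
        4 * Real.pi ^ ((3:ℝ)/2) / Real.Gamma (1/4) ^ 2 * x ^ 2 := by
  have hx1 : x < 1 := hx.trans_lt (by norm_num)
  have hodd := summable_oddCoeff_mul_pow hx0 hx1
  have heven := summable_evenCoeff_mul_pow hx0 hx1
  have heven' := (summable_nat_add_iff 1).2 heven
  rw [← evenCoeff_zero, ← evenCoeff_one, ← oddCoeff_zero]
  change ∑' k : ℕ, (evenCoeff k * x ^ (2 * k) - oddCoeff k * x ^ (2 * k + 1)) ≤ _
  have htail : ∑' k : ℕ, evenCoeff (k + 1 + 1) * x ^ (2 * (k + 1 + 1)) ≤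
      ∑' k : ℕ, oddCoeff (k + 1) * x ^ (2 * (k + 1) + 1) :=
    ((summable_nat_add_iff 1).2 heven').tsum_le_tsum
      (fun k => evenCoeff_succ_mul_pow_le hx0 hx1.le (k + 1)) ((summable_nat_add_iff 1).2 hodd)
  rw [heven.tsum_sub hodd, heven.tsum_eq_zero_add, heven'.tsum_eq_zero_add,
    hodd.tsum_eq_zero_add]
  norm_num at htail ⊢
  linarith
end
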